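/- Suppose the Borel probability measure μ on Λ satisfies the large deviation property for the family {μ_γ}. Then for every integer k ≥ 1, the probability measures μ_{T,k} converge weakly to the product measure μ^{⊗k} on Λ^k as T → ∞. -/

import Mathlib

open MeasureTheory Filter Topology
open scoped ENNReal NNReal Classical

/-- Averages of a uniformly bounded function over finite sets converge to `a` as soon as, for every
`ε > 0`, the proportion of points where the function is `ε`-far from `a` tends to `0`. -/
theorem tendsto_average_of_tendsto_proportion {ι : Type*} (P : ℕ → Finset ι)
    (hP : ∀ᶠ T in atTop, (P T).Nonempty) (f : ι → ℝ) (a M : ℝ) (hM : ∀ i, |f i - a| ≤ M)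
    (h : ∀ ε > 0, Tendsto
      (fun T => (((P T).filter (fun i => ε ≤ |f i - a|)).card : ℝ) / ((P T).card : ℝ))
      atTop (𝓝 0)) :
    Tendsto (fun T => ((P T).card : ℝ)⁻¹ * ∑ i ∈ P T, f i) atTop (𝓝 a) := by
  rw [Metric.tendsto_nhds]
  intro ε hε
  have hlim : Tendsto (fun T => ε / 2 +
      M * ((((P T).filter (fun i => ε / 2 ≤ |f i - a|)).card : ℝ) / ((P T).card : ℝ)))
      atTop (𝓝 (ε / 2)) := by
    simpa using ((h (ε / 2) (half_pos hε)).const_mul M).const_add (ε / 2)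
  filter_upwards [hP, hlim.eventually_lt_const (half_lt_self hε)] with T hT hlt
  have hcard : (0 : ℝ) < (P T).card := by exact_mod_cast hT.card_pos
  rw [Real.dist_eq]
  refine lt_of_le_of_lt ?_ hlt
  have hsub : ((P T).card : ℝ)⁻¹ * ∑ i ∈ P T, f i - a =
      ((P T).card : ℝ)⁻¹ * ∑ i ∈ P T, (f i - a) := by
    rw [Finset.sum_sub_distrib, Finset.sum_const, nsmul_eq_mul]
    field_simp
  have hsum : ∑ i ∈ P T, |f i - a| ≤
      ∑ i ∈ P T, (ε / 2 + if ε / 2 ≤ |f i - a| then M else 0) := by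
    refine Finset.sum_le_sum fun i _ => ?_
    have hi := hM i
    split_ifs with hc <;> linarith
  rw [hsub, abs_mul, abs_of_pos (inv_pos.2 hcard)]
  calc ((P T).card : ℝ)⁻¹ * |∑ i ∈ P T, (f i - a)|
      ≤ ((P T).card : ℝ)⁻¹ * ∑ i ∈ P T, (ε / 2 + if ε / 2 ≤ |f i - a| then M else 0) := by
        gcongr
        exact (Finset.abs_sum_le_sum_abs _ _).trans hsum
    _ = ε / 2 + M * ((((P T).filter (fun i => ε / 2 ≤ |f i - a|)).card : ℝ) /
          ((P T).card : ℝ)) := by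
        rw [Finset.sum_add_distrib, ← Finset.sum_filter, Finset.sum_const, Finset.sum_const,
          nsmul_eq_mul, nsmul_eq_mul]
        field_simp

/-- The integral of a bounded continuous function against the `k`-fold power of a probability
measure depends continuously on the measure. -/
theorem continuous_integral_pi_const {Λ : Type*} [MetricSpace Λ] [SecondCountableTopology Λ]
    [MeasurableSpace Λ] [BorelSpace Λ] (k : ℕ) (ψ : BoundedContinuousFunction (Fin k → Λ) ℝ) :
    Continuous fun m : ProbabilityMeasure Λ =>
      ∫ x, ψ x ∂(Measure.pi (fun _ : Fin k => (m : Measure Λ))) := by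
  have hdiag : Continuous fun m : ProbabilityMeasure Λ =>
      ProbabilityMeasure.pi (fun _ : Fin k => m) :=
    ProbabilityMeasure.continuous_pi.comp (_root_.continuous_pi fun _ => continuous_id)
  refine continuous_iff_continuousAt.2 fun m => ?_
  exact ProbabilityMeasure.tendsto_iff_forall_integral_tendsto.1 (hdiag.tendsto m) ψ

/-- If the Borel probability measure `μ` on `Λ` satisfies the large
deviation property for the family `{μ_γ}` (for every compact set `K` of probability
measures in the weak topology with `μ ∉ K`, one has
`limsup_{T→∞} (1/T) log(#{γ ∈ P_T : μ_γ ∈ K}/#P_T) < 0`, i.e. the proportion decays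
exponentially), then for every `k ≥ 1` the measures `μ_{T,k}` converge weakly to `μ^{⊗k}`:
the integrals of every bounded continuous function converge. -/

theorem statement3
    {Λ : Type*} [MetricSpace Λ] [CompactSpace Λ] [MeasurableSpace Λ] [BorelSpace Λ]
    {ι : Type*} (P : ℕ → Finset ι) (μγ : ι → ProbabilityMeasure Λ)
    (hP : ∀ T : ℕ, 2 ≤ T → (P T).Nonempty)
    (μ : ProbabilityMeasure Λ)
    (hLDP : ∀ K : Set (ProbabilityMeasure Λ), IsCompact K → μ ∉ K →
      ∃ c : ℝ, c < 0 ∧ ∀ᶠ T : ℕ in atTop,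
        (((P T).filter (fun γ => μγ γ ∈ K)).card : ℝ) / ((P T).card : ℝ) ≤
          Real.exp (c * T)) :
    ∀ k : ℕ, 1 ≤ k →
      ∀ μTk : ℕ → Measure (Fin k → Λ),
        (∀ T : ℕ, μTk T =
          ((P T).card : ℝ≥0∞)⁻¹ •
            ∑ γ ∈ P T, Measure.pi (fun _ : Fin k => (μγ γ : Measure Λ))) →
        ∀ ψ : BoundedContinuousFunction (Fin k → Λ) ℝ,
          Tendsto (fun T : ℕ => ∫ x, ψ x ∂(μTk T)) atTop
            (𝓝 (∫ x, ψ x ∂(Measure.pi (fun _ : Fin k => (μ : Measure Λ))))) := by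
  intro k _ μTk hμTk ψ
  set F : ProbabilityMeasure Λ → ℝ := fun m =>
    ∫ x, ψ x ∂(Measure.pi (fun _ : Fin k => (m : Measure Λ))) with hF
  have hFcont : Continuous F := continuous_integral_pi_const k ψ
  have hFbound : ∀ m, |F m| ≤ ‖ψ‖ := fun m => by
    simpa [hF, Real.norm_eq_abs] using
      ψ.norm_integral_le_norm (Measure.pi (fun _ : Fin k => (m : Measure Λ)))
  have hint : ∀ T, ∫ x, ψ x ∂(μTk T) =
      ((P T).card : ℝ)⁻¹ * ∑ γ ∈ P T, F (μγ γ) := fun T => by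
    rw [hμTk T, integral_smul_measure, integral_finsetSum_measure fun γ _ => ψ.integrable _]
    simp [hF]
  simp_rw [hint]
  refine tendsto_average_of_tendsto_proportion P
    ((eventually_ge_atTop 2).mono hP) (fun γ => F (μγ γ)) (F μ) (‖ψ‖ + ‖ψ‖)
    (fun γ => (abs_sub _ _).trans (add_le_add (hFbound _) (hFbound _))) fun ε hε => ?_
  have hKclosed : IsClosed {m : ProbabilityMeasure Λ | ε ≤ |F m - F μ|} :=
    isClosed_le continuous_const (hFcont.sub continuous_const).abs
  obtain ⟨c, hc, hle⟩ := hLDP _ hKclosed.isCompact (by simpa using hε)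
  have hexp : Tendsto (fun T : ℕ => Real.exp (c * T)) atTop (𝓝 0) :=
    Real.tendsto_exp_atBot.comp
      (tendsto_natCast_atTop_atTop.const_mul_atTop_of_neg hc)
  exact squeeze_zero' (Eventually.of_forall fun T => by positivity) hle hexp
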